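/- The logic L satisfies the orthomodular law: for all f, g ∈ L with f(P) ≤ g(P) for every P ∈ S, the functional g − f belongs to L; g − f is the greatest lower bound in L of 1−f and g (i.e. g−f ≤ 1−f and g−f ≤ g pointwise, and every h ∈ L with h ≤ 1−f and h ≤ g pointwise satisfies h ≤ g−f); and g is the least upper bound in L of f and g−f (i.e. every h ∈ L with f ≤ h and g−f ≤ h pointwise satisfies g ≤ h). In particular f ∨ (fᶜ ∧ g) = g where fᶜ = 1−f, so L is an orthomodular poset. -/

import Mathlib

namespace BoxWorld

/-- A (2,2)-box assignment: `P a b α β` stands for `P(αβ|ab)`, where the measurement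
settings are `a, b ∈ Fin 2` (with `x = 0`, `y = 1`) and the outcomes are `α, β ∈ Fin 2`. -/
abbrev Box : Type := Fin 2 → Fin 2 → Fin 2 → Fin 2 → ℝ

/-- (P1) positivity, (P2) normalization, (P3) non-signalling. -/
def IsState (P : Box) : Prop :=
  (∀ a b α β, 0 ≤ P a b α β) ∧
  (∀ a b, ∑ α : Fin 2, ∑ β : Fin 2, P a b α β = 1) ∧
  (∀ a b b' α, ∑ β : Fin 2, P a b α β = ∑ β : Fin 2, P a b' α β) ∧
  (∀ a a' b β, ∑ α : Fin 2, P a b α β = ∑ α : Fin 2, P a' b α β)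

/-- The set `S` of (2,2)-box states, as a subtype. -/
abbrev State : Type := {P : Box // IsState P}

/-- The elementary question `e[ab, αβ]`, as a functional on states. -/
def elem (a b α β : Fin 2) : State → ℝ := fun P => P.1 a b α β

abbrev Idx : Type := Fin 2 × Fin 2 × Fin 2 × Fin 2

def elemI (i : Idx) : State → ℝ := elem i.1 i.2.1 i.2.2.1 i.2.2.2

/-- The logic `L` of the (2,2)-box world: all functionals `f = Σ_{e ∈ A} e`, where `A` is a
set of elementary questions whose pointwise sum is `≤ 1` at every state, together with the
complements `1 - f` of all such functionals. -/
def InLogic (f : State → ℝ) : Prop :=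
  (∃ A : Finset Idx, (∀ P : State, ∑ i ∈ A, elemI i P ≤ 1) ∧
      f = fun P => ∑ i ∈ A, elemI i P) ∨
  (∃ A : Finset Idx, (∀ P : State, ∑ i ∈ A, elemI i P ≤ 1) ∧
      f = fun P => 1 - ∑ i ∈ A, elemI i P)

/-- Two elementary questions are orthogonal when they ask for different outcomes of a common
setting. -/
def Orth (i j : Idx) : Prop :=
  (i.1 = j.1 ∧ i.2.2.1 ≠ j.2.2.1) ∨ (i.2.1 = j.2.1 ∧ i.2.2.2 ≠ j.2.2.2)

/-- The deterministic state in which setting `a` yields `u a` and setting `b` yields `v b`. -/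
def detState (u v : Fin 2 → Fin 2) : State :=
  ⟨fun a b α β => if u a = α ∧ v b = β then 1 else 0, by
    refine ⟨fun a b α β => by positivity, ?_, ?_, ?_⟩ <;> intros <;>
      simp [ite_and, Finset.sum_ite_eq]⟩

theorem elemI_nonneg (i : Idx) (P : State) : 0 ≤ elemI i P := P.2.1 _ _ _ _

theorem orth_of_add_le_one {i j : Idx} (h : ∀ P : State, elemI i P + elemI j P ≤ 1) :
    Orth i j := by
  by_contra hn
  obtain ⟨a, b, α, β⟩ := i
  obtain ⟨a', b', α', β'⟩ := j
  have h1 := h (detState (fun s => if s = a then α else α') (fun s => if s = b then β else β'))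
  simp only [Orth, not_or, not_and, not_not] at hn
  have ha : (if a' = a then α else α') = α' := by
    split_ifs with e
    · exact hn.1 e.symm
    · rfl
  have hb : (if b' = b then β else β') = β' := by
    split_ifs with e
    · exact hn.2 e.symm
    · rfl
  simp only [elemI, elem, detState, ha, hb] at h1
  norm_num at h1

theorem pairwise_orth_of_sum_le_one {A : Finset Idx}
    (h : ∀ P : State, ∑ i ∈ A, elemI i P ≤ 1) : (A : Set Idx).Pairwise Orth := by
  intro i hi j hj hij
  refine orth_of_add_le_one fun P => le_trans ?_ (h P)
  rw [← Finset.sum_pair (f := fun k => elemI k P) hij]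
  refine Finset.sum_le_sum_of_subset_of_nonneg ?_ fun k _ _ => elemI_nonneg k P
  simpa [Finset.insert_subset_iff] using ⟨hi, hj⟩

theorem pairwise_orth_union {A B : Finset Idx} (hA : (A : Set Idx).Pairwise Orth)
    (hB : (B : Set Idx).Pairwise Orth)
    (h : ∀ P : State, ∑ i ∈ A, elemI i P + ∑ i ∈ B, elemI i P ≤ 1) :
    Disjoint A B ∧ ((A ∪ B : Finset Idx) : Set Idx).Pairwise Orth := by
  have key : ∀ i ∈ A, ∀ j ∈ B, Orth i j := fun i hi j hj =>
    orth_of_add_le_one fun P => le_trans (add_le_add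
      (Finset.single_le_sum (f := fun k => elemI k P) (fun k _ => elemI_nonneg k P) hi)
      (Finset.single_le_sum (f := fun k => elemI k P) (fun k _ => elemI_nonneg k P) hj)) (h P)
  have symm : ∀ i j, Orth i j → Orth j i := fun i j => by
    simp only [Orth, ne_eq, eq_comm, imp_self]
  refine ⟨Finset.disjoint_left.2 fun i hi hi' => ?_, ?_⟩
  · simpa [Orth] using key i hi i hi'
  · rw [Finset.coe_union]
    intro i hi j hj hij
    rcases hi with hi | hi <;> rcases hj with hj | hj
    · exact hA hi hj hij
    · exact key i hi j hj
    · exact symm _ _ (key j hj i hi)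
    · exact hB hi hj hij

/-- The measurement that first uses setting `a` on the left and then, on outcome `α`, uses
setting `c α` on the right. -/
def leftFirst (a : Fin 2) (c : Fin 2 → Fin 2) : Finset Idx :=
  {i | i.1 = a ∧ i.2.1 = c i.2.2.1}

/-- The measurement that first uses setting `b` on the right and then, on outcome `β`, uses
setting `c β` on the left. -/
def rightFirst (b : Fin 2) (c : Fin 2 → Fin 2) : Finset Idx :=
  {i | i.2.1 = b ∧ i.1 = c i.2.2.2}

theorem pairwise_orth_leftFirst (a : Fin 2) (c : Fin 2 → Fin 2) :
    (leftFirst a c : Set Idx).Pairwise Orth := by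
  rintro ⟨a₁, b₁, α₁, β₁⟩ h₁ ⟨a₂, b₂, α₂, β₂⟩ h₂ hne
  simp only [leftFirst, Finset.coe_filter, Finset.mem_univ, true_and, Set.mem_ofPred_eq] at h₁ h₂
  simp only [Orth]
  grind

theorem pairwise_orth_rightFirst (b : Fin 2) (c : Fin 2 → Fin 2) :
    (rightFirst b c : Set Idx).Pairwise Orth := by
  rintro ⟨a₁, b₁, α₁, β₁⟩ h₁ ⟨a₂, b₂, α₂, β₂⟩ h₂ hne
  simp only [rightFirst, Finset.coe_filter, Finset.mem_univ, true_and, Set.mem_ofPred_eq] at h₁ h₂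
  simp only [Orth]
  grind

theorem sum_leftFirst (a : Fin 2) (c : Fin 2 → Fin 2) (P : State) :
    ∑ i ∈ leftFirst a c, elemI i P = 1 := by
  have h : ∑ i ∈ leftFirst a c, elemI i P = ∑ α, ∑ β, P.1 a (c α) α β := by
    simp [leftFirst, Finset.sum_filter, Fintype.sum_prod_type, elemI, elem, ite_and]
    generalize c 0 = s
    generalize c 1 = t
    fin_cases s <;> fin_cases t <;> simp <;> ring
  rw [h, ← P.2.2.1 a 0]
  exact Finset.sum_congr rfl fun α _ => P.2.2.2.1 a _ _ α

theorem sum_rightFirst (b : Fin 2) (c : Fin 2 → Fin 2) (P : State) :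
    ∑ i ∈ rightFirst b c, elemI i P = 1 := by
  have h : ∑ i ∈ rightFirst b c, elemI i P = ∑ β, ∑ α, P.1 (c β) b α β := by
    simp [rightFirst, Finset.sum_filter, Fintype.sum_prod_type, elemI, elem, ite_and]
    generalize c 0 = s
    generalize c 1 = t
    fin_cases s <;> fin_cases t <;> simp <;> ring
  rw [h, ← P.2.2.1 0 b, Finset.sum_comm (f := fun α β => P.1 0 b α β)]
  exact Finset.sum_congr rfl fun β _ => P.2.2.2.2 _ _ b β

theorem subset_leftFirst_or_rightFirst {A : Finset Idx} (hA : (A : Set Idx).Pairwise Orth) :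
    (∃ a c, A ⊆ leftFirst a c) ∨ ∃ b c, A ⊆ rightFirst b c := by
  have hA' : ∀ i ∈ A, ∀ j ∈ A, i ≠ j → Orth i j := fun i hi j hj => hA hi hj
  by_cases h : ∃ a, ∀ i ∈ A, i.1 = a
  · obtain ⟨a, ha⟩ := h
    have hc : ∀ α, ∃ b, ∀ i ∈ A, i.2.2.1 = α → i.2.1 = b := by
      intro α
      by_cases hα : ∃ i ∈ A, i.2.2.1 = α
      · obtain ⟨i, hi, rfl⟩ := hα
        refine ⟨i.2.1, fun j hj hji => ?_⟩
        by_cases hij : j = i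
        · rw [hij]
        · rcases hA' j hj i hi hij with h | h
          · exact absurd hji h.2
          · exact h.1
      · exact ⟨0, fun i hi e => absurd ⟨i, hi, e⟩ hα⟩
    choose c hc using hc
    exact Or.inl ⟨a, c, fun i hi => by simpa [leftFirst] using ⟨ha i hi, hc _ i hi rfl⟩⟩
  · obtain ⟨b, hb⟩ : ∃ b, ∀ i ∈ A, i.2.1 = b := by
      push Not at h
      obtain ⟨i, hi, -⟩ := h 0
      obtain ⟨j, hj, hij⟩ := h i.1
      refine ⟨i.2.1, fun k hk => ?_⟩
      have h₁ := hA' j hj i hi (fun e => hij (by rw [e]))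
      have h₂ := hA' k hk i hi
      have h₃ := hA' k hk j hj
      simp only [Orth] at h₁ h₂ h₃
      grind
    have hc : ∀ β, ∃ a, ∀ i ∈ A, i.2.2.2 = β → i.1 = a := by
      intro β
      by_cases hβ : ∃ i ∈ A, i.2.2.2 = β
      · obtain ⟨i, hi, rfl⟩ := hβ
        refine ⟨i.1, fun j hj hji => ?_⟩
        by_cases hij : j = i
        · rw [hij]
        · rcases hA' j hj i hi hij with h | h
          · exact h.1
          · exact absurd hji h.2
      · exact ⟨0, fun i hi e => absurd ⟨i, hi, e⟩ hβ⟩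
    choose c hc using hc
    exact Or.inr ⟨b, c, fun i hi => by simpa [rightFirst] using ⟨hb i hi, hc _ i hi rfl⟩⟩

theorem exists_orth_complement {A : Finset Idx} (hA : (A : Set Idx).Pairwise Orth) :
    ∃ B : Finset Idx, (B : Set Idx).Pairwise Orth ∧
      ∀ P : State, ∑ i ∈ A, elemI i P + ∑ i ∈ B, elemI i P = 1 := by
  obtain ⟨M, hAM, hM, hsum⟩ : ∃ M, A ⊆ M ∧ (M : Set Idx).Pairwise Orth ∧
      ∀ P : State, ∑ i ∈ M, elemI i P = 1 := by
    rcases subset_leftFirst_or_rightFirst hA with ⟨a, c, h⟩ | ⟨b, c, h⟩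
    · exact ⟨_, h, pairwise_orth_leftFirst a c, sum_leftFirst a c⟩
    · exact ⟨_, h, pairwise_orth_rightFirst b c, sum_rightFirst b c⟩
  refine ⟨M \ A, hM.mono (by exact_mod_cast Finset.sdiff_subset), fun P => ?_⟩
  rw [add_comm, Finset.sum_sdiff hAM, hsum]

theorem sum_le_one_of_pairwise_orth {A : Finset Idx} (hA : (A : Set Idx).Pairwise Orth)
    (P : State) : ∑ i ∈ A, elemI i P ≤ 1 := by
  obtain ⟨B, -, h⟩ := exists_orth_complement hA
  linarith [h P, Finset.sum_nonneg fun i (_ : i ∈ B) => elemI_nonneg i P]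

theorem inLogic_iff {f : State → ℝ} :
    InLogic f ↔ ∃ A : Finset Idx, (A : Set Idx).Pairwise Orth ∧
      ∀ P, f P = ∑ i ∈ A, elemI i P := by
  constructor
  · rintro (⟨A, hA, rfl⟩ | ⟨A, hA, rfl⟩)
    · exact ⟨A, pairwise_orth_of_sum_le_one hA, fun _ => rfl⟩
    · obtain ⟨B, hB, h⟩ := exists_orth_complement (pairwise_orth_of_sum_le_one hA)
      exact ⟨B, hB, fun P => by linarith [h P]⟩
  · rintro ⟨A, hA, h⟩
    exact Or.inl ⟨A, sum_le_one_of_pairwise_orth hA, funext h⟩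

theorem InLogic.nonneg {f : State → ℝ} (hf : InLogic f) (P : State) : 0 ≤ f P := by
  obtain ⟨A, -, h⟩ := inLogic_iff.1 hf
  exact h P ▸ Finset.sum_nonneg fun i _ => elemI_nonneg i P

theorem InLogic.le_one {f : State → ℝ} (hf : InLogic f) (P : State) : f P ≤ 1 := by
  obtain ⟨A, hA, h⟩ := inLogic_iff.1 hf
  exact h P ▸ sum_le_one_of_pairwise_orth hA P

theorem InLogic.one_sub {f : State → ℝ} (hf : InLogic f) : InLogic fun P => 1 - f P := by
  obtain ⟨A, hA, h⟩ := inLogic_iff.1 hf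
  exact Or.inr ⟨A, sum_le_one_of_pairwise_orth hA, by simp only [h]⟩

theorem InLogic.add {f g : State → ℝ} (hf : InLogic f) (hg : InLogic g)
    (hfg : ∀ P, f P + g P ≤ 1) : InLogic fun P => f P + g P := by
  obtain ⟨A, hA, hfA⟩ := inLogic_iff.1 hf
  obtain ⟨B, hB, hgB⟩ := inLogic_iff.1 hg
  obtain ⟨hd, hAB⟩ := pairwise_orth_union hA hB fun P => by simpa only [hfA, hgB] using hfg P
  exact inLogic_iff.2 ⟨A ∪ B, hAB, fun P => by rw [Finset.sum_union hd, hfA, hgB]⟩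

/-- Three pairwise orthogonal elements of the logic are jointly orthogonal. -/
theorem InLogic.add_add_le_one {f g h : State → ℝ} (hf : InLogic f) (hg : InLogic g)
    (hh : InLogic h) (hfg : ∀ P, f P + g P ≤ 1) (hfh : ∀ P, f P + h P ≤ 1)
    (hgh : ∀ P, g P + h P ≤ 1) (P : State) : f P + g P + h P ≤ 1 := by
  obtain ⟨A, hA, hfA⟩ := inLogic_iff.1 hf
  obtain ⟨B, hB, hgB⟩ := inLogic_iff.1 hg
  obtain ⟨C, hC, hhC⟩ := inLogic_iff.1 hh
  simp only [hfA, hgB, hhC] at hfg hfh hgh ⊢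
  obtain ⟨hdAB, hAB⟩ := pairwise_orth_union hA hB hfg
  obtain ⟨hdAC, hAC⟩ := pairwise_orth_union hA hC hfh
  obtain ⟨hdBC, hBC⟩ := pairwise_orth_union hB hC hgh
  have hABC : ((A ∪ B ∪ C : Finset Idx) : Set Idx).Pairwise Orth := by
    intro i hi j hj hij
    simp only [Finset.coe_union, Set.mem_union, Finset.mem_coe] at hi hj
    have h₁ := @hAB i; have h₂ := @hAC i; have h₃ := @hBC i
    simp only [Finset.coe_union, Set.mem_union, Finset.mem_coe] at h₁ h₂ h₃
    grind
  rw [← Finset.sum_union hdAB, ← Finset.sum_union (Finset.disjoint_union_left.2 ⟨hdAC, hdBC⟩)]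
  exact sum_le_one_of_pairwise_orth hABC P

/-- the orthomodular law in the logic `L`: for `f ≤ g` in `L`, `g − f ∈ L`,
`g − f` is the greatest lower bound of `1 − f` and `g`, and `g` is the least upper bound
of `f` and `g − f`; in particular `f ∨ (fᶜ ∧ g) = g`, so `L` is an orthomodular poset. -/
theorem orthomodular_law (f g : State → ℝ) (hf : InLogic f) (hg : InLogic g)
    (hle : ∀ P : State, f P ≤ g P) :
    InLogic (fun P => g P - f P) ∧
    (∀ P : State, g P - f P ≤ 1 - f P) ∧
    (∀ P : State, g P - f P ≤ g P) ∧
    (∀ h : State → ℝ, InLogic h → (∀ P : State, h P ≤ 1 - f P) →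
      (∀ P : State, h P ≤ g P) → ∀ P : State, h P ≤ g P - f P) ∧
    (∀ h : State → ℝ, InLogic h → (∀ P : State, f P ≤ h P) →
      (∀ P : State, g P - f P ≤ h P) → ∀ P : State, g P ≤ h P) := by
  have hsub : InLogic fun P => g P - f P := by
    have h := (hf.add hg.one_sub fun P => by linarith [hle P]).one_sub
    convert h using 2
    ring
  refine ⟨hsub, fun P => by linarith [hg.le_one P], fun P => by linarith [hf.nonneg P],
    fun h hh hhf hhg P => ?_, fun h hh hfh hsubh P => ?_⟩
  · linarith [hf.add_add_le_one hh hg.one_sub (fun P => by linarith [hhf P])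
      (fun P => by linarith [hle P]) (fun P => by linarith [hhg P]) P]
  · linarith [hf.add_add_le_one hsub hh.one_sub (fun P => by linarith [hg.le_one P])
      (fun P => by linarith [hfh P]) (fun P => by linarith [hsubh P]) P]


end BoxWorld
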